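/- Let τ be a strictly convex norm on ℝ², let m > 0 and M ∈ ℕ. Then the set Ω^min_{M,m}, consisting of all F ∈ Ω^min_{E̲} such that every connected component of F contains a point of E, where E ranges over subsets of ∂Q_m with |E| ≤ M and E̲ over partitions of E, is a compact subset of the space of nonempty compact subsets of ℝ² equipped with the Hausdorff metric. -/

import Mathlib

open scoped ENNReal

/-- The plane `ℝ²`. -/
abbrev P2 : Type := ℝ × ℝ

/-- `τ : ℝ² → ℝ` is a norm. -/
structure IsNorm (τ : P2 → ℝ) : Prop where
  eq_zero_iff : ∀ x : P2, τ x = 0 ↔ x = 0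
  smul_eq : ∀ (c : ℝ) (x : P2), τ (c • x) = |c| * τ x
  add_le : ∀ x y : P2, τ (x + y) ≤ τ x + τ y

/-- `τ` is a strictly convex norm: `τ(x+y) < τ(x)+τ(y)` whenever `x` and `y` are not
nonnegative multiples of one another. -/
def IsStrictlyConvexNorm (τ : P2 → ℝ) : Prop :=
  IsNorm τ ∧ ∀ x y : P2, ¬ (∃ c : ℝ, 0 ≤ c ∧ (x = c • y ∨ y = c • x)) →
    τ (x + y) < τ x + τ y

/-- The `τ`-diameter of a set (in `ℝ≥0∞`). -/
noncomputable def tauDiam (τ : P2 → ℝ) (A : Set P2) : ℝ≥0∞ :=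
  ⨆ x ∈ A, ⨆ y ∈ A, ENNReal.ofReal (τ (x - y))

/-- The one-dimensional Hausdorff measure of `S` computed in the metric
`(x,y) ↦ τ(x−y)`: `lim_{ε→0} inf {Σ diam_τ(Aᵢ) : S ⊆ ⋃ Aᵢ, diam_τ(Aᵢ) ≤ ε}`. -/
noncomputable def tauLen (τ : P2 → ℝ) (S : Set P2) : ℝ≥0∞ :=
  ⨆ (ε : ℝ) (_ : 0 < ε),
    ⨅ (A : ℕ → Set P2) (_ : S ⊆ ⋃ i, A i)
      (_ : ∀ i, tauDiam τ (A i) ≤ ENNReal.ofReal ε),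
      ∑' i, tauDiam τ (A i)

/-- `Ep` (a family `E₁,…,E_r`) is a partition of `E`: nonempty, pairwise disjoint pieces
whose union is `E`. -/
def IsPartitionOf {r : ℕ} (Ep : Fin r → Set P2) (E : Set P2) : Prop :=
  (∀ j, (Ep j).Nonempty) ∧ (∀ j k, j ≠ k → Disjoint (Ep j) (Ep k)) ∧ (⋃ j, Ep j) = E

/-- `Ω_{E̲}`: compact sets `S` such that each `E_j` is contained in a single connected
component of `S`. -/
def OmegaSet {r : ℕ} (Ep : Fin r → Set P2) : Set (Set P2) :=
  {S | IsCompact S ∧ ∀ j, ∃ x ∈ S, Ep j ⊆ connectedComponentIn S x}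

/-- `τ_{E̲} = inf {τ(S) : S ∈ Ω_{E̲}}`. -/
noncomputable def tauMin (τ : P2 → ℝ) {r : ℕ} (Ep : Fin r → Set P2) : ℝ≥0∞ :=
  ⨅ S ∈ OmegaSet Ep, tauLen τ S

/-- `Ω^min_{E̲}`: the Steiner forests of `E̲`. -/
def OmegaMinSet (τ : P2 → ℝ) {r : ℕ} (Ep : Fin r → Set P2) : Set (Set P2) :=
  {S ∈ OmegaSet Ep | tauLen τ S = tauMin τ Ep}

/-- The box `Q_m = [−m,m]² ⊂ ℝ²`. -/
def Qbox (m : ℝ) : Set P2 := Set.Icc (-m) m ×ˢ Set.Icc (-m) m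

/-- `Ω^min_{M,m}`: all Steiner forests `F ∈ Ω^min_{E̲}`, over `E ⊆ ∂Q_m` with `|E| ≤ M` and
partitions `E̲` of `E`, each of whose connected components contains a point of `E`. -/
def OmegaMinMm (τ : P2 → ℝ) (M : ℕ) (m : ℝ) : Set (Set P2) :=
  {F | ∃ (E : Set P2) (r : ℕ) (Ep : Fin r → Set P2),
    E ⊆ frontier (Qbox m) ∧ E.Finite ∧ E.ncard ≤ M ∧ IsPartitionOf Ep E ∧
    F ∈ OmegaMinSet τ Ep ∧ ∀ x ∈ F, (connectedComponentIn F x ∩ E).Nonempty}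

/-- The `τ`-Hausdorff "distance" `d_τ(A,B) = sup_{a∈A} inf_{b∈B} τ(a−b)` (in `ℝ≥0∞`). -/
noncomputable def dTau (τ : P2 → ℝ) (A B : Set P2) : ℝ≥0∞ :=
  ⨆ a ∈ A, ⨅ b ∈ B, ENNReal.ofReal (τ (a - b))

namespace Steiner

/-- `d` bounds the `τ`-diameter of `A`. -/
def DB (τ : P2 → ℝ) (A : Set P2) (d : ℝ) : Prop := ∀ x ∈ A, ∀ y ∈ A, τ (x - y) ≤ d

theorem tau_zero {τ : P2 → ℝ} (hN : IsNorm τ) : τ 0 = 0 := (hN.eq_zero_iff 0).2 rfl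

theorem tau_neg {τ : P2 → ℝ} (hN : IsNorm τ) (x : P2) : τ (-x) = τ x := by
  have := hN.smul_eq (-1) x
  simpa using this

theorem tau_nonneg {τ : P2 → ℝ} (hN : IsNorm τ) (x : P2) : 0 ≤ τ x := by
  have h := hN.add_le x (-x)
  rw [add_neg_cancel, tau_zero hN, tau_neg hN] at h
  linarith

theorem tau_sub_comm {τ : P2 → ℝ} (hN : IsNorm τ) (x y : P2) : τ (x - y) = τ (y - x) := by
  rw [← tau_neg hN, neg_sub]

theorem tau_tri {τ : P2 → ℝ} (hN : IsNorm τ) (x y z : P2) : τ (x - z) ≤ τ (x - y) + τ (y - z) := by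
  have := hN.add_le (x - y) (y - z)
  simpa using this

theorem tau_bound {τ : P2 → ℝ} (hN : IsNorm τ) : ∃ C : ℝ, 0 < C ∧ ∀ x, τ x ≤ C * ‖x‖ := by
  refine ⟨τ (1, 0) + τ (0, 1) + 1, ?_, ?_⟩
  · have := tau_nonneg hN (1, 0)
    have := tau_nonneg hN (0, 1)
    linarith
  · intro x
    have h1 := tau_nonneg hN (1, 0)
    have h2 := tau_nonneg hN (0, 1)
    have hx : x = x.1 • ((1, 0) : P2) + x.2 • ((0, 1) : P2) := by
      ext <;> simp
    have h3 : τ x ≤ |x.1| * τ (1, 0) + |x.2| * τ (0, 1) := by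
      calc τ x = τ (x.1 • ((1, 0) : P2) + x.2 • ((0, 1) : P2)) := by rw [← hx]
        _ ≤ _ := hN.add_le _ _
        _ = _ := by rw [hN.smul_eq, hN.smul_eq]
    have h4 : |x.1| ≤ ‖x‖ := by simpa using norm_fst_le x
    have h5 : |x.2| ≤ ‖x‖ := by simpa using norm_snd_le x
    have h6 := norm_nonneg x
    nlinarith [mul_le_mul_of_nonneg_right h4 h1, mul_le_mul_of_nonneg_right h5 h2]

theorem tau_lower {τ : P2 → ℝ} (hN : IsNorm τ) : ∃ C : ℝ, 0 < C ∧ ∀ x, ‖x‖ ≤ C * τ x := by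
  obtain ⟨C, hC, hb⟩ := tau_bound hN
  have hcont : Continuous τ := by
    refine (LipschitzWith.of_le_add_mul ⟨C, hC.le⟩ ?_).continuous
    intro x y
    have h1 := hN.add_le y (x - y)
    have h2 := hb (x - y)
    rw [dist_eq_norm]
    simp only [add_sub_cancel] at h1
    change τ x ≤ τ y + C * _
    linarith
  have hS : IsCompact (Metric.sphere (0 : P2) 1) := isCompact_sphere _ _
  have hne : (Metric.sphere (0 : P2) 1).Nonempty := ⟨(1, 0), by simp [Prod.norm_def]⟩
  obtain ⟨z, hz, hmin⟩ := hS.exists_isMinOn hne hcont.continuousOn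
  have hz0 : 0 < τ z := by
    refine lt_of_le_of_ne (tau_nonneg hN z) (fun h => ?_)
    have := (hN.eq_zero_iff z).1 h.symm
    simp [this] at hz
  refine ⟨(τ z)⁻¹, inv_pos.2 hz0, fun x => ?_⟩
  by_cases hx : x = 0
  · simp [hx, tau_zero hN]
  · have hx' : 0 < ‖x‖ := norm_pos_iff.2 hx
    have h1 : τ z ≤ τ (‖x‖⁻¹ • x) := hmin (by simp [norm_smul, hx'.ne'])
    rw [hN.smul_eq, abs_of_pos (inv_pos.2 hx')] at h1
    rw [inv_mul_eq_div, le_div_iff₀ hz0]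
    calc ‖x‖ * τ z ≤ ‖x‖ * (‖x‖⁻¹ * τ x) := by gcongr
      _ = τ x := by field_simp

theorem tau_cont {τ : P2 → ℝ} (hN : IsNorm τ) : Continuous τ := by
  obtain ⟨C, hC, hb⟩ := tau_bound hN
  refine (LipschitzWith.of_le_add_mul ⟨C, hC.le⟩ ?_).continuous
  intro x y
  have h1 := hN.add_le y (x - y)
  have h2 := hb (x - y)
  rw [dist_eq_norm]
  simp only [add_sub_cancel] at h1
  change τ x ≤ τ y + C * _
  linarith

theorem tauDiam_le {τ : P2 → ℝ} {A : Set P2} {d : ℝ} (h : DB τ A d) : tauDiam τ A ≤ ENNReal.ofReal d :=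
  iSup₂_le fun x hx => iSup₂_le fun y hy => ENNReal.ofReal_le_ofReal (h x hx y hy)

theorem DB_of_tauDiam {τ : P2 → ℝ} {A : Set P2} (h : tauDiam τ A ≠ ⊤) : DB τ A (tauDiam τ A).toReal := by
  intro x hx y hy
  have h1 : ENNReal.ofReal (τ (x - y)) ≤ tauDiam τ A :=
    le_trans (le_iSup₂ (f := fun y (_ : y ∈ A) => ENNReal.ofReal (τ (x - y))) y hy)
      (le_iSup₂ (f := fun x (_ : x ∈ A) => ⨆ y ∈ A, ENNReal.ofReal (τ (x - y))) x hx)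
  exact (ENNReal.ofReal_le_iff_le_toReal h).1 h1

theorem DB_union {τ : P2 → ℝ} (hN : IsNorm τ) {A B : Set P2} {a b : ℝ} (hA : DB τ A a) (hB : DB τ B b)
    (h : (A ∩ B).Nonempty) : DB τ (A ∪ B) (a + b) := by
  obtain ⟨z, hzA, hzB⟩ := h
  have ha : 0 ≤ a := (tau_nonneg hN _).trans (hA z hzA z hzA)
  have hb : 0 ≤ b := (tau_nonneg hN _).trans (hB z hzB z hzB)
  rintro x (hx | hx) y (hy | hy)
  · have := hA x hx y hy; linarith
  · have := hA x hx z hzA; have := hB z hzB y hy; have := tau_tri hN x z y; linarith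
  · have := hB x hx z hzB; have := hA z hzA y hy; have := tau_tri hN x z y; linarith
  · have := hB x hx y hy; linarith

theorem DB_thicken {τ : P2 → ℝ} (hN : IsNorm τ) {A : Set P2} {a δ : ℝ} (hA : DB τ A a) :
    DB τ {x | ∃ y ∈ A, τ (x - y) < δ} (a + 2 * δ) := by
  rintro x ⟨x', hx', hxx⟩ y ⟨y', hy', hyy⟩
  have := hA x' hx' y' hy'
  have := tau_tri hN x x' y
  have := tau_tri hN x' y' y
  rw [tau_sub_comm hN] at hyy
  linarith

theorem isOpen_thicken {τ : P2 → ℝ} (hN : IsNorm τ) (A : Set P2) (δ : ℝ) : IsOpen {x | ∃ y ∈ A, τ (x - y) < δ} := by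
  have : {x | ∃ y ∈ A, τ (x - y) < δ} = ⋃ y ∈ A, {x | τ (x - y) < δ} := by
    ext; simp
  rw [this]
  refine isOpen_biUnion fun y _ => ?_
  exact isOpen_lt ((tau_cont hN).comp (by fun_prop)) continuous_const

/-- Finite forests of index sets, built by adding roots and linked leaves. -/
inductive Good (U : ℕ → Set P2) : Finset ℕ → ℕ → Prop
  | empty : Good U ∅ 0
  | root (s : Finset ℕ) (n j : ℕ) : Good U s n → j ∉ s → Good U (insert j s) (n + 1)
  | link (s : Finset ℕ) (n j i : ℕ) : Good U s n → j ∉ s → i ∈ s → (U i ∩ U j).Nonempty →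
      Good U (insert j s) n

theorem cutting {τ : P2 → ℝ} (hN : IsNorm τ) {κ η : ℝ} (hκ : 0 ≤ κ) (hκη : κ < η)
    {U : ℕ → Set P2} {s : Finset ℕ} {n : ℕ} (h : Good U s n) (hU : ∀ i ∈ s, DB τ (U i) κ) :
    ∀ (B : ℕ → Set P2) (a : ℕ → ℝ), (∀ i ∈ s, U i ⊆ B i) → (∀ i ∈ s, DB τ (B i) (a i)) →
      (∀ i ∈ s, 0 ≤ a i ∧ a i < η) →
      ∃ (D : List (Set P2 × ℝ)) (k : ℕ), D.length ≤ k + n ∧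
        (∀ q ∈ D, DB τ q.1 q.2 ∧ 0 ≤ q.2 ∧ q.2 ≤ 2 * η) ∧
        (∀ i ∈ s, ∀ x ∈ B i, ∃ q ∈ D, x ∈ q.1) ∧
        (D.map Prod.snd).sum ≤ ∑ i ∈ s, a i + k * κ ∧ k * η ≤ ∑ i ∈ s, a i + k * κ := by
  induction h with
  | empty =>
    intro B a _ _ _
    exact ⟨[], 0, by simp⟩
  | root s n j hs hj ih =>
    intro B a hUB hB ha
    obtain ⟨D, k, h1, h2, h3, h4, h5⟩ := ih (fun i hi => hU i (Finset.mem_insert_of_mem hi)) B a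
      (fun i hi => hUB i (Finset.mem_insert_of_mem hi))
      (fun i hi => hB i (Finset.mem_insert_of_mem hi))
      (fun i hi => ha i (Finset.mem_insert_of_mem hi))
    have haj := ha j (Finset.mem_insert_self _ _)
    refine ⟨(B j, a j) :: D, k, by simp; omega, ?_, ?_, ?_, ?_⟩
    · intro q hq
      rcases List.mem_cons.1 hq with rfl | hq
      · exact ⟨hB j (Finset.mem_insert_self _ _), haj.1, by simp only; linarith⟩
      · exact h2 q hq
    · intro i hi x hx
      rcases Finset.mem_insert.1 hi with rfl | hi
      · exact ⟨_, List.mem_cons_self, hx⟩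
      · obtain ⟨q, hq, hxq⟩ := h3 i hi x hx
        exact ⟨q, List.mem_cons_of_mem _ hq, hxq⟩
    · rw [Finset.sum_insert hj]; simp; linarith
    · rw [Finset.sum_insert hj]; linarith [haj.1]
  | link s n j i hs hj hi hij ih =>
    intro B a hUB hB ha
    have hji : ∀ l ∈ s, l ∈ insert j s := fun l hl => Finset.mem_insert_of_mem hl
    have hjj := Finset.mem_insert_self j s
    have haj := ha j hjj
    have hai := ha i (hji i hi)
    have hDB : DB τ (B i ∪ B j) (a i + a j) := DB_union hN (hB i (hji i hi)) (hB j hjj)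
      (hij.mono (Set.inter_subset_inter (hUB i (hji i hi)) (hUB j hjj)))
    have hsum : ∀ b, ∑ l ∈ s, Function.update a i b l = b + (∑ l ∈ s, a l - a i) := by
      intro b
      rw [Finset.sum_update_of_mem hi, Finset.sum_eq_add_sum_sdiff_singleton_of_mem hi a]
      ring
    rw [Finset.sum_insert hj]
    by_cases hlt : a i + a j < η
    · obtain ⟨D, k, h1, h2, h3, h4, h5⟩ := ih (fun l hl => hU l (hji l hl))
        (Function.update B i (B i ∪ B j)) (Function.update a i (a i + a j))
        (by
          intro l hl
          by_cases hli : l = i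
          · subst hli; simp; exact (hUB l (hji l hl)).trans Set.subset_union_left
          · simp [hli]; exact hUB l (hji l hl))
        (by
          intro l hl
          by_cases hli : l = i
          · subst hli; simpa using hDB
          · simp [hli]; exact hB l (hji l hl))
        (by
          intro l hl
          by_cases hli : l = i
          · subst hli; simp; exact ⟨by linarith, hlt⟩
          · simp [hli]; exact ha l (hji l hl))
      rw [hsum] at h4 h5
      refine ⟨D, k, h1, h2, ?_, by linarith, by linarith⟩
      intro l hl x hx
      rcases Finset.mem_insert.1 hl with rfl | hl
      · exact h3 i hi x (by simp; exact Or.inr hx)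
      · by_cases hli : l = i
        · subst hli; exact h3 l hl x (by simp; exact Or.inl hx)
        · exact h3 l hl x (by simpa [hli] using hx)
    · obtain ⟨D, k, h1, h2, h3, h4, h5⟩ := ih (fun l hl => hU l (hji l hl))
        (Function.update B i (U i)) (Function.update a i κ)
        (by
          intro l hl
          by_cases hli : l = i
          · subst hli; simp
          · simp [hli]; exact hUB l (hji l hl))
        (by
          intro l hl
          by_cases hli : l = i
          · subst hli; simpa using hU l (hji l hl)
          · simp [hli]; exact hB l (hji l hl))
        (by
          intro l hl
          by_cases hli : l = i
          · subst hli; simp; exact ⟨hκ, hκη⟩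
          · simp [hli]; exact ha l (hji l hl))
      rw [hsum] at h4 h5
      refine ⟨(B i ∪ B j, a i + a j) :: D, k + 1, by simp; omega, ?_, ?_, ?_, ?_⟩
      · intro q hq
        rcases List.mem_cons.1 hq with rfl | hq
        · exact ⟨hDB, by simp only; linarith, by simp only; linarith⟩
        · exact h2 q hq
      · intro l hl x hx
        rcases Finset.mem_insert.1 hl with rfl | hl
        · exact ⟨_, List.mem_cons_self, Or.inr hx⟩
        · by_cases hli : l = i
          · subst hli; exact ⟨_, List.mem_cons_self, Or.inl hx⟩
          · obtain ⟨q, hq, hxq⟩ := h3 l hl x (by simpa [hli] using hx)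
            exact ⟨q, List.mem_cons_of_mem _ hq, hxq⟩
      · simp; linarith
      · push_cast; linarith

theorem exhaust_one {U : ℕ → Set P2} (hUo : ∀ i, IsOpen (U i)) {t s : Finset ℕ} {n : ℕ}
    (hst : s ⊆ t) (hs : Good U s n) {C : Set P2} (hC : IsPreconnected C)
    (hCt : C ⊆ ⋃ i ∈ t, U i) :
    ∃ s' n', s ⊆ s' ∧ s' ⊆ t ∧ n' ≤ n + 1 ∧ Good U s' n' ∧ C ⊆ ⋃ i ∈ s', U i := by
  classical
  rcases C.eq_empty_or_nonempty with rfl | ⟨x, hx⟩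
  · exact ⟨s, n, subset_rfl, hst, by omega, hs, by simp⟩
  obtain ⟨i, hit, hxi⟩ : ∃ i ∈ t, x ∈ U i := by simpa using hCt hx
  obtain ⟨s1, n1, hss1, hs1t, hn1, hg1, his1⟩ :
      ∃ s1 n1, s ⊆ s1 ∧ s1 ⊆ t ∧ n1 ≤ n + 1 ∧ Good U s1 n1 ∧ i ∈ s1 := by
    by_cases his : i ∈ s
    · exact ⟨s, n, subset_rfl, hst, by omega, hs, his⟩
    · exact ⟨insert i s, n + 1, Finset.subset_insert _ _, Finset.insert_subset hit hst, le_rfl,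
        Good.root s n i hs his, Finset.mem_insert_self _ _⟩
  obtain ⟨s', hs', hmax⟩ := Finset.exists_max_image
    (t.powerset.filter fun s' => s1 ⊆ s' ∧ Good U s' n1) Finset.card
    ⟨s1, by simp [hs1t, hg1]⟩
  simp only [Finset.mem_filter, Finset.mem_powerset] at hs' hmax
  obtain ⟨hs't, hs1s', hg'⟩ := hs'
  refine ⟨s', n1, hss1.trans hs1s', hs't, hn1, hg', ?_⟩
  intro y hy
  by_contra hys
  obtain ⟨j, hjt, hyj⟩ : ∃ j ∈ t, y ∈ U j := by simpa using hCt hy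
  have hjs : j ∉ s' := fun hj => hys (Set.mem_biUnion hj hyj)
  obtain ⟨z, -, hz1, hz2⟩ := hC (⋃ i ∈ s', U i) (⋃ i ∈ t \ s', U i)
    (isOpen_biUnion fun i _ => hUo i) (isOpen_biUnion fun i _ => hUo i)
    (by
      intro w hw
      obtain ⟨l, hlt, hwl⟩ : ∃ l ∈ t, w ∈ U l := by simpa using hCt hw
      by_cases hl : l ∈ s'
      · exact Or.inl (Set.mem_biUnion hl hwl)
      · exact Or.inr (Set.mem_biUnion (show l ∈ t \ s' by simp [hlt, hl]) hwl))
    ⟨x, hx, Set.mem_biUnion (hs1s' his1) hxi⟩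
    ⟨y, hy, Set.mem_biUnion (show j ∈ t \ s' by simp [hjt, hjs]) hyj⟩
  obtain ⟨l, hl, hzl⟩ : ∃ l ∈ s', z ∈ U l := by simpa using hz1
  obtain ⟨k, ⟨hkt, hks⟩, hzk⟩ : ∃ k, (k ∈ t ∧ k ∉ s') ∧ z ∈ U k := by simpa using hz2
  have := hmax (insert k s') ⟨Finset.insert_subset hkt hs't,
    hs1s'.trans (Finset.subset_insert _ _), Good.link s' n1 k l hg' hks hl ⟨z, hzl, hzk⟩⟩
  rw [Finset.card_insert_of_notMem hks] at this
  omega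

theorem exhaust {U : ℕ → Set P2} (hUo : ∀ i, IsOpen (U i)) {t : Finset ℕ} {M : ℕ}
    {c : Fin M → Set P2} (hc : ∀ i, IsPreconnected (c i)) (hct : ∀ i, c i ⊆ ⋃ i ∈ t, U i) :
    ∃ s n, s ⊆ t ∧ n ≤ M ∧ Good U s n ∧ ∀ i, c i ⊆ ⋃ i ∈ s, U i := by
  classical
  have key : ∀ A : Finset (Fin M), ∃ s n, s ⊆ t ∧ n ≤ A.card ∧ Good U s n ∧
      ∀ i ∈ A, c i ⊆ ⋃ i ∈ s, U i := by
    intro A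
    induction A using Finset.induction_on with
    | empty => exact ⟨∅, 0, by simp, by simp, Good.empty, by simp⟩
    | insert a A ha ih =>
      obtain ⟨s, n, hst, hn, hg, hA⟩ := ih
      obtain ⟨s', n', hss', hs't, hn', hg', hC⟩ := exhaust_one hUo hst hg (hc a) (hct a)
      refine ⟨s', n', hs't, by rw [Finset.card_insert_of_notMem ha]; omega, hg', ?_⟩
      intro i hi
      rcases Finset.mem_insert.1 hi with rfl | hi
      · exact hC
      · exact (hA i hi).trans (Set.biUnion_subset_biUnion_left hss')
  obtain ⟨s, n, h1, h2, h3, h4⟩ := key Finset.univ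
  exact ⟨s, n, h1, by simpa using h2, h3, fun i => h4 i (Finset.mem_univ i)⟩

theorem exists_cover {τ : P2 → ℝ} {S : Set P2} {L : ℝ≥0∞} (h : tauLen τ S < L) {ε : ℝ}
    (hε : 0 < ε) : ∃ A : ℕ → Set P2, S ⊆ ⋃ i, A i ∧
      (∀ i, tauDiam τ (A i) ≤ ENNReal.ofReal ε) ∧ ∑' i, tauDiam τ (A i) < L := by
  have h1 := lt_of_le_of_lt (le_iSup₂ (f := fun (ε : ℝ) (_ : 0 < ε) =>
    ⨅ (A : ℕ → Set P2) (_ : S ⊆ ⋃ i, A i)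
      (_ : ∀ i, tauDiam τ (A i) ≤ ENNReal.ofReal ε), ∑' i, tauDiam τ (A i)) ε hε) h
  simp only [iInf_lt_iff] at h1
  obtain ⟨A, hA, hA', h2⟩ := h1
  exact ⟨A, hA, hA', h2⟩

theorem tauLen_le_of {τ : P2 → ℝ} {S : Set P2} {L : ℝ≥0∞}
    (h : ∀ ε : ℝ, 0 < ε → ∀ e : ℝ, 0 < e → ∃ A : ℕ → Set P2, S ⊆ ⋃ i, A i ∧
      (∀ i, tauDiam τ (A i) ≤ ENNReal.ofReal ε) ∧
      ∑' i, tauDiam τ (A i) ≤ L + ENNReal.ofReal e) : tauLen τ S ≤ L := by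
  refine iSup₂_le fun ε hε => ?_
  refine ENNReal.le_of_forall_pos_le_add fun e he _ => ?_
  obtain ⟨A, h1, h2, h3⟩ := h ε hε e he
  rw [ENNReal.ofReal_coe_nnreal] at h3
  exact (iInf_le_of_le A (iInf₂_le_of_le h1 h2 le_rfl)).trans h3

theorem tauLen_mono {τ : P2 → ℝ} {S T : Set P2} (h : S ⊆ T) : tauLen τ S ≤ tauLen τ T := by
  refine iSup₂_mono fun ε hε => ?_
  refine le_iInf fun A => le_iInf₂ fun h1 h2 => ?_
  exact iInf_le_of_le A (iInf₂_le_of_le (h.trans h1) h2 le_rfl)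

/-- Prepend a finite list of sets to a countable cover. -/
theorem prepend {τ : P2 → ℝ} {ε : ℝ} (A : ℕ → Set P2)
    (hA : ∀ i, tauDiam τ (A i) ≤ ENNReal.ofReal ε) (D : List (Set P2 × ℝ))
    (hD : ∀ q ∈ D, DB τ q.1 q.2 ∧ 0 ≤ q.2 ∧ q.2 ≤ ε) :
    ∃ A' : ℕ → Set P2, (⋃ i, A i) ⊆ ⋃ i, A' i ∧ (∀ q ∈ D, q.1 ⊆ ⋃ i, A' i) ∧
      (∀ i, tauDiam τ (A' i) ≤ ENNReal.ofReal ε) ∧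
      ∑' i, tauDiam τ (A' i) ≤ ∑' i, tauDiam τ (A i) + ENNReal.ofReal (D.map Prod.snd).sum := by
  induction D with
  | nil => exact ⟨A, subset_rfl, by simp, hA, by simp⟩
  | cons q D ih =>
    obtain ⟨A', h1, h2, h3, h4⟩ := ih (fun q hq => hD q (List.mem_cons_of_mem _ hq))
    obtain ⟨hq1, hq2, hq3⟩ := hD q List.mem_cons_self
    let A'' : ℕ → Set P2 := fun n => Nat.casesOn n q.1 A'
    have hsub : (⋃ i, A' i) ⊆ ⋃ i, A'' i :=
      Set.iUnion_subset fun i => Set.subset_iUnion A'' (i + 1)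
    refine ⟨A'', h1.trans hsub, ?_, ?_, ?_⟩
    · intro p hp
      rcases List.mem_cons.1 hp with rfl | hp
      · exact Set.subset_iUnion A'' 0
      · exact (h2 p hp).trans hsub
    · intro i
      cases i with
      | zero => exact (tauDiam_le hq1).trans (ENNReal.ofReal_le_ofReal hq3)
      | succ i => exact h3 i
    · rw [tsum_eq_zero_add' ENNReal.summable]
      have hs : 0 ≤ (D.map Prod.snd).sum := by
        refine List.sum_nonneg fun x hx => ?_
        obtain ⟨p, hp, rfl⟩ := List.mem_map.1 hx
        exact (hD p (List.mem_cons_of_mem _ hp)).2.1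
      rw [List.map_cons, List.sum_cons, ENNReal.ofReal_add hq2 hs]
      calc tauDiam τ q.1 + ∑' i, tauDiam τ (A' i)
          ≤ ENNReal.ofReal q.2 + (∑' i, tauDiam τ (A i) +
            ENNReal.ofReal (D.map Prod.snd).sum) := add_le_add (tauDiam_le hq1) h4
        _ = _ := by ring

theorem tauDiam_empty {τ : P2 → ℝ} : tauDiam τ ∅ = 0 := by simp [tauDiam]

/-- `T` has finite covers at all scales, of total diameter at most `l`. -/
def ListCov (τ : P2 → ℝ) (T : Set P2) (l : ℝ) : Prop :=
  ∀ ε : ℝ, 0 < ε → ∃ D : List (Set P2 × ℝ),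
    (∀ q ∈ D, DB τ q.1 q.2 ∧ 0 ≤ q.2 ∧ q.2 ≤ ε) ∧ (∀ x ∈ T, ∃ q ∈ D, x ∈ q.1) ∧
    (D.map Prod.snd).sum ≤ l

theorem ListCov.union {τ : P2 → ℝ} {T T' : Set P2} {l l' : ℝ} (h : ListCov τ T l)
    (h' : ListCov τ T' l') : ListCov τ (T ∪ T') (l + l') := by
  intro ε hε
  obtain ⟨D, h1, h2, h3⟩ := h ε hε
  obtain ⟨D', h1', h2', h3'⟩ := h' ε hε
  refine ⟨D ++ D', ?_, ?_, ?_⟩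
  · intro q hq
    rcases List.mem_append.1 hq with hq | hq
    exacts [h1 q hq, h1' q hq]
  · rintro x (hx | hx)
    · obtain ⟨q, hq, hxq⟩ := h2 x hx
      exact ⟨q, List.mem_append_left _ hq, hxq⟩
    · obtain ⟨q, hq, hxq⟩ := h2' x hx
      exact ⟨q, List.mem_append_right _ hq, hxq⟩
  · simp; linarith

theorem ListCov.empty {τ : P2 → ℝ} : ListCov τ ∅ 0 := fun _ _ => ⟨[], by simp⟩

theorem ListCov.biUnion {τ : P2 → ℝ} {ι : Type*} (A : Finset ι) {T : ι → Set P2} {l : ι → ℝ}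
    (h : ∀ i, ListCov τ (T i) (l i)) : ListCov τ (⋃ i ∈ A, T i) (∑ i ∈ A, l i) := by
  classical
  induction A using Finset.induction_on with
  | empty => simpa using ListCov.empty
  | insert a A ha ih =>
    rw [Finset.sum_insert ha, Finset.set_biUnion_insert]
    exact (h a).union ih

theorem tauLen_union_le {τ : P2 → ℝ} {S T : Set P2} {l : ℝ} (h : ListCov τ T l) :
    tauLen τ (S ∪ T) ≤ tauLen τ S + ENNReal.ofReal l := by
  by_cases htop : tauLen τ S = ⊤
  · simp [htop]
  refine tauLen_le_of fun ε hε e he => ?_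
  obtain ⟨A, h1, h2, h3⟩ := exists_cover
    (show tauLen τ S < tauLen τ S + ENNReal.ofReal e from
      ENNReal.lt_add_right htop (by simpa using he)) hε
  obtain ⟨D, g1, g2, g3⟩ := h ε hε
  obtain ⟨A', k1, k2, k3, k4⟩ := prepend A h2 D g1
  refine ⟨A', ?_, k3, ?_⟩
  · rintro x (hx | hx)
    · exact k1 (h1 hx)
    · obtain ⟨q, hq, hxq⟩ := g2 x hx
      exact k2 q hq hxq
  · calc _ ≤ _ := k4
      _ ≤ (tauLen τ S + ENNReal.ofReal e) + ENNReal.ofReal l :=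
        add_le_add h3.le (ENNReal.ofReal_le_ofReal g3)
      _ = _ := by ring

theorem listCov_segment {τ : P2 → ℝ} (hN : IsNorm τ) (a b : P2) :
    ListCov τ (segment ℝ a b) (τ (b - a)) := by
  intro ε hε
  obtain ⟨n, hn⟩ := exists_nat_gt (τ (b - a) / ε)
  have hτ0 := tau_nonneg hN (b - a)
  have hn0 : (0 : ℝ) < n := lt_of_le_of_lt (by positivity) hn
  have hn1 : τ (b - a) / n ≤ ε := by
    rw [div_lt_iff₀ hε] at hn
    rw [div_le_iff₀ hn0]; linarith
  refine ⟨(List.range n).map fun k : ℕ => ((fun t : ℝ => a + t • (b - a)) ''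
    Set.Icc ((k : ℝ) / n) ((k + 1) / n), τ (b - a) / n), ?_, ?_, ?_⟩
  · intro q hq
    obtain ⟨k, hk, rfl⟩ := List.mem_map.1 hq
    refine ⟨?_, by positivity, hn1⟩
    rintro _ ⟨t, ht, rfl⟩ _ ⟨u, hu, rfl⟩
    have : a + t • (b - a) - (a + u • (b - a)) = (t - u) • (b - a) := by
      rw [sub_smul]; abel
    simp only [this, hN.smul_eq]
    have h1 : |t - u| ≤ 1 / n := by
      have : ((k : ℝ) + 1) / n = k / n + 1 / n := by ring
      rw [this] at ht hu
      rw [abs_le]; constructor <;> linarith [ht.1, ht.2, hu.1, hu.2]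
    calc |t - u| * τ (b - a) ≤ 1 / n * τ (b - a) := by gcongr
      _ = _ := by ring
  · intro x hx
    rw [segment_eq_image'] at hx
    obtain ⟨t, ht, rfl⟩ := hx
    have hnn : 0 < n := by exact_mod_cast hn0
    obtain ⟨k, hk, h1, h2⟩ : ∃ k < n, (k : ℝ) / n ≤ t ∧ t ≤ (k + 1) / n := by
      by_cases ht1 : t = 1
      · refine ⟨n - 1, by omega, ?_, ?_⟩
        · rw [div_le_iff₀ hn0, ht1, Nat.cast_sub (by omega)]; push_cast; linarith
        · rw [le_div_iff₀ hn0, ht1, Nat.cast_sub (by omega)]; push_cast; linarith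
      · have ht0 : 0 ≤ t * n := mul_nonneg ht.1 hn0.le
        refine ⟨⌊t * n⌋₊, ?_, ?_, ?_⟩
        · rw [Nat.floor_lt ht0]
          have : t < 1 := lt_of_le_of_ne ht.2 ht1
          nlinarith
        · rw [div_le_iff₀ hn0]; exact Nat.floor_le ht0
        · rw [le_div_iff₀ hn0]; exact (Nat.lt_floor_add_one _).le
    refine ⟨_, List.mem_map.2 ⟨k, List.mem_range.2 hk, rfl⟩, ?_⟩
    exact ⟨t, ⟨h1, h2⟩, rfl⟩
  · rw [List.map_map]
    simp only [Function.comp_def, List.map_const', List.sum_replicate, List.length_range,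
      nsmul_eq_mul]
    rw [mul_div_cancel₀ _ hn0.ne']

theorem coverG {τ : P2 → ℝ} (hN : IsNorm τ) {M : ℕ} {c : Fin M → Set P2}
    (hcomp : IsCompact (⋃ i, c i)) (hc : ∀ i, IsPreconnected (c i)) {L κ η : ℝ}
    (hL : tauLen τ (⋃ i, c i) < ENNReal.ofReal L) (hκ : 0 < κ) (hκη : κ < η) :
    ∃ (D : List (Set P2 × ℝ)) (k : ℕ), D.length ≤ k + M ∧
        (∀ q ∈ D, DB τ q.1 q.2 ∧ 0 ≤ q.2 ∧ q.2 ≤ 2 * η) ∧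
        (∀ x ∈ ⋃ i, c i, ∃ q ∈ D, x ∈ q.1) ∧
        (D.map Prod.snd).sum ≤ L + k * κ ∧ k * η ≤ L + k * κ := by
  obtain ⟨A, hA1, hA2, hA3⟩ := exists_cover hL (half_pos hκ)
  have hslack : min (ENNReal.ofReal L - ∑' i, tauDiam τ (A i)) (ENNReal.ofReal (κ / 2)) ≠ 0 := by
    refine (lt_min ?_ ?_).ne'
    · exact tsub_pos_of_lt hA3
    · simpa using hκ
  obtain ⟨e, he0, he1⟩ := ENNReal.exists_pos_sum_of_countable hslack ℕ
  have hfin : ∀ i, tauDiam τ (A i) ≠ ⊤ := fun i =>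
    ne_top_of_le_ne_top ENNReal.ofReal_ne_top (hA2 i)
  let U : ℕ → Set P2 := fun i => {x | ∃ y ∈ A i, τ (x - y) < e i / 2}
  let a : ℕ → ℝ := fun i => (tauDiam τ (A i)).toReal + e i
  have hUa : ∀ i, DB τ (U i) (a i) := by
    intro i
    have := DB_thicken hN (δ := e i / 2) (DB_of_tauDiam (hfin i))
    rwa [mul_div_cancel₀ _ (two_ne_zero)] at this
  have hd : ∀ i, (tauDiam τ (A i)).toReal ≤ κ / 2 := fun i =>
    ENNReal.toReal_le_of_le_ofReal (half_pos hκ).le (hA2 i)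
  have hek : ∀ i, (e i : ℝ) ≤ κ / 2 := by
    intro i
    have h1 : (e i : ℝ≥0∞) ≤ ENNReal.ofReal (κ / 2) :=
      (ENNReal.le_tsum i).trans (he1.le.trans (min_le_right _ _))
    have := ENNReal.toReal_le_of_le_ofReal (half_pos hκ).le h1
    simpa using this
  have hak : ∀ i, a i ≤ κ := fun i => by
    have := hd i; have := hek i; simp only [a]; linarith
  have ha0 : ∀ i, 0 ≤ a i := fun i => by positivity
  have hUo : ∀ i, IsOpen (U i) := fun i => isOpen_thicken hN _ _
  have hGU : (⋃ i, c i) ⊆ ⋃ i, U i := by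
    refine hA1.trans (Set.iUnion_mono fun i x hx => ⟨x, hx, ?_⟩)
    simp only [sub_self, tau_zero hN]
    have := he0 i
    positivity
  obtain ⟨t, ht⟩ := hcomp.elim_finite_subcover U hUo hGU
  obtain ⟨s, n, hst, hn, hg, hcov⟩ := exhaust hUo hc
    (fun i => (Set.subset_iUnion c i).trans ht)
  have hsum : ∑ i ∈ s, a i ≤ L := by
    have h1 : ENNReal.ofReal (∑ i ∈ s, a i) ≤ ENNReal.ofReal L := by
      rw [ENNReal.ofReal_sum_of_nonneg (fun i _ => ha0 i)]
      calc ∑ i ∈ s, ENNReal.ofReal (a i) = ∑ i ∈ s, (tauDiam τ (A i) + e i) := by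
            refine Finset.sum_congr rfl fun i _ => ?_
            simp only [a]
            rw [ENNReal.ofReal_add ENNReal.toReal_nonneg (NNReal.coe_nonneg (e i)), ENNReal.ofReal_toReal (hfin i),
              ENNReal.ofReal_coe_nnreal]
        _ ≤ ∑' i, (tauDiam τ (A i) + e i) := ENNReal.sum_le_tsum _
        _ = ∑' i, tauDiam τ (A i) + ∑' i, (e i : ℝ≥0∞) := ENNReal.tsum_add
        _ ≤ ∑' i, tauDiam τ (A i) + (ENNReal.ofReal L - ∑' i, tauDiam τ (A i)) := by
            gcongr; exact he1.le.trans (min_le_left _ _)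
        _ = ENNReal.ofReal L := add_tsub_cancel_of_le hA3.le
    have hLpos : 0 < L := by
      by_contra hL0
      rw [ENNReal.ofReal_of_nonpos (not_lt.1 hL0)] at hL
      exact not_lt_zero hL
    exact (ENNReal.ofReal_le_ofReal_iff hLpos.le).1 h1
  obtain ⟨D, k, h1, h2, h3, h4, h5⟩ := cutting hN hκ.le hκη hg
    (fun i _ x hx y hy => (hUa i x hx y hy).trans (hak i)) U a (fun _ _ => subset_rfl)
    (fun i _ => hUa i) (fun i _ => ⟨ha0 i, (hak i).trans_lt hκη⟩)
  refine ⟨D, k, by omega, h2, ?_, by linarith, by linarith⟩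
  intro x hx
  obtain ⟨j, hj⟩ := Set.mem_iUnion.1 hx
  obtain ⟨i, hi, hxi⟩ : ∃ i ∈ s, x ∈ U i := by simpa using hcov j hj
  exact h3 i hi x hxi

theorem golab {τ : P2 → ℝ} (hN : IsNorm τ) {M : ℕ} {F : Set P2} {L : ℝ} (hL : 0 ≤ L)
    (h : ∀ δ : ℝ, 0 < δ → ∃ c : Fin M → Set P2, IsCompact (⋃ i, c i) ∧
      (∀ i, IsPreconnected (c i)) ∧ tauLen τ (⋃ i, c i) < ENNReal.ofReal (L + δ) ∧
      ∀ x ∈ F, ∃ y ∈ ⋃ i, c i, τ (x - y) < δ) :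
    tauLen τ F ≤ ENNReal.ofReal L := by
  refine tauLen_le_of fun ε hε e he => ?_
  set η := ε / 4 with hη
  have hη0 : 0 < η := by positivity
  set N : ℝ := 2 * (L + 1) / η + M with hNdef
  have hN0 : 0 ≤ N := by positivity
  set κ := min (η / 2) (e / (3 * (N + 1))) with hκdef
  set δ := min (min 1 (ε / 4)) (e / (6 * (N + 1))) with hδdef
  have hκ0 : 0 < κ := by positivity
  have hδ0 : 0 < δ := by positivity
  have hκη : κ ≤ η / 2 := min_le_left _ _
  have hκe : κ * (N + 1) ≤ e / 3 := by
    have : κ ≤ e / (3 * (N + 1)) := min_le_right _ _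
    calc κ * (N + 1) ≤ e / (3 * (N + 1)) * (N + 1) := by gcongr
      _ = e / 3 := by field_simp
  have hδe : δ * (N + 1) ≤ e / 6 := by
    have : δ ≤ e / (6 * (N + 1)) := min_le_right _ _
    calc δ * (N + 1) ≤ e / (6 * (N + 1)) * (N + 1) := by gcongr
      _ = e / 6 := by field_simp
  have hδ1 : δ ≤ 1 := (min_le_left _ _).trans (min_le_left _ _)
  have hδε : δ ≤ ε / 4 := (min_le_left _ _).trans (min_le_right _ _)
  obtain ⟨c, hcomp, hc, hlen, hF⟩ := h δ hδ0
  obtain ⟨D, k, h1, h2, h3, h4, h5⟩ := coverG hN hcomp hc hlen hκ0 (by linarith : κ < η)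
  have hk0 : (0 : ℝ) ≤ k := Nat.cast_nonneg k
  have hk : (k : ℝ) ≤ 2 * (L + 1) / η := by
    rw [le_div_iff₀ hη0]
    nlinarith [mul_le_mul_of_nonneg_left hκη hk0]
  have hlenD : (D.length : ℝ) ≤ N := by
    have : (D.length : ℝ) ≤ k + M := by exact_mod_cast h1
    linarith
  have hkN : (k : ℝ) ≤ N := by
    have : (0 : ℝ) ≤ M := Nat.cast_nonneg M
    linarith
  obtain ⟨A', -, k2, k3, k4⟩ := prepend (τ := τ) (ε := ε) (fun _ => ∅)
    (by simp [tauDiam_empty])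
    (D.map fun q => ({x | ∃ y ∈ q.1, τ (x - y) < δ / 2 * 2}, q.2 + 2 * δ))
    (by
      intro q hq
      obtain ⟨p, hp, rfl⟩ := List.mem_map.1 hq
      obtain ⟨g1, g2, g3⟩ := h2 p hp
      refine ⟨?_, by simp only; linarith, by simp only; linarith⟩
      have := DB_thicken hN (δ := δ) g1
      simpa using this)
  refine ⟨A', ?_, k3, k4.trans ?_⟩
  · intro x hx
    obtain ⟨y, hy, hxy⟩ := hF x hx
    obtain ⟨q, hq, hyq⟩ := h3 y hy
    refine k2 _ (List.mem_map.2 ⟨q, hq, rfl⟩) ⟨y, hyq, ?_⟩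
    linarith
  · rw [← ENNReal.ofReal_add hL he.le]
    simp only [tauDiam_empty, tsum_zero, zero_add]
    refine ENNReal.ofReal_le_ofReal ?_
    rw [List.map_map]
    simp only [Function.comp_def]
    rw [List.sum_map_add]
    simp only [List.map_const', List.sum_replicate, nsmul_eq_mul]
    have hs : (D.map Prod.snd).sum = (D.map fun q => q.2).sum := rfl
    rw [← hs]
    have e1 : (k : ℝ) * κ ≤ e / 3 := by nlinarith
    have e2 : (D.length : ℝ) * (2 * δ) ≤ e / 3 := by nlinarith
    have e3 : δ ≤ e / 6 := by nlinarith
    linarith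

theorem DB_of_connected {τ : P2 → ℝ} (hN : IsNorm τ) {C : Set P2} (hcomp : IsCompact C)
    (hC : IsPreconnected C) {L : ℝ} (hL : tauLen τ C < ENNReal.ofReal L) : DB τ C L := by
  have hLpos : 0 < L := by
    by_contra hL0
    rw [ENNReal.ofReal_of_nonpos (not_lt.1 hL0)] at hL
    exact not_lt_zero hL
  have hU : (⋃ _ : Fin 1, C) = C := Set.iUnion_const C
  obtain ⟨D, k, h1, h2, h3, h4, h5⟩ := coverG hN (M := 1) (c := fun _ => C) (by rwa [hU])
    (fun _ => hC) (L := L) (κ := 1) (η := L + 2) (by rwa [hU]) one_pos (by linarith)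
  rw [hU] at h3
  have hk : k = 0 := by
    by_contra hk
    have : (1 : ℝ) ≤ k := by exact_mod_cast Nat.one_le_iff_ne_zero.2 hk
    nlinarith
  subst hk
  intro x hx y hy
  obtain ⟨q, hq, hxq⟩ := h3 x hx
  obtain ⟨p, hp, hyp⟩ := h3 y hy
  match D, h1 with
  | [], _ => simp at hq
  | [r], _ =>
    simp at hq hp
    subst hq; subst hp
    have := (h2 _ List.mem_cons_self).1 x hxq y hyp
    simp at h4
    linarith
  | _ :: _ :: _, h1 => simp at h1

open TopologicalSpace in
theorem isClosed_preconn : IsClosed {K : NonemptyCompacts P2 | IsPreconnected (K : Set P2)} := by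
  rw [← isOpen_compl_iff, isOpen_iff_forall_mem_open]
  intro K hK
  have hK' : ¬ IsPreconnected (K : Set P2) := hK
  rw [isPreconnected_iff_subset_of_fully_disjoint_closed K.isCompact.isClosed] at hK'
  push Not at hK'
  obtain ⟨u, v, hu, hv, huv, hd, hnu, hnv⟩ := hK'
  obtain ⟨U, V, hU, hV, huU, hvV, hUV⟩ := normal_separation hu hv hd
  refine ⟨{L | (L : Set P2) ⊆ U ∪ V} ∩ ({L | ((L : Set P2) ∩ U).Nonempty} ∩
    {L | ((L : Set P2) ∩ V).Nonempty}), ?_, ?_, ?_⟩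
  · rintro L ⟨h1, h2, h3⟩ hL
    obtain ⟨x, -, hx1, hx2⟩ := hL U V hU hV h1 h2 h3
    exact Set.disjoint_left.1 hUV hx1 hx2
  · exact (NonemptyCompacts.isOpen_subsets_of_isOpen (hU.union hV)).inter
      ((NonemptyCompacts.isOpen_inter_nonempty_of_isOpen hU).inter
        (NonemptyCompacts.isOpen_inter_nonempty_of_isOpen hV))
  · refine ⟨huv.trans (Set.union_subset_union huU hvV), ?_, ?_⟩
    · obtain ⟨x, hx, hxv⟩ := Set.not_subset.1 hnv
      exact ⟨x, hx, huU ((huv hx).resolve_right hxv)⟩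
    · obtain ⟨x, hx, hxv⟩ := Set.not_subset.1 hnu
      exact ⟨x, hx, hvV ((huv hx).resolve_left hxv)⟩

open TopologicalSpace in
theorem isClosed_memNC : IsClosed {z : P2 × NonemptyCompacts P2 | z.1 ∈ (z.2 : Set P2)} := by
  rw [← isOpen_compl_iff]
  have h := (NonemptyCompacts.isOpen_setOfPred_disjoint_coe (α := P2))
  have hc : Continuous (fun z : P2 × NonemptyCompacts P2 =>
      (({z.1} : NonemptyCompacts P2), z.2)) :=
    (NonemptyCompacts.isometry_singleton.continuous.comp continuous_fst).prodMk continuous_snd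
  convert h.preimage hc using 1
  ext z
  simp

open TopologicalSpace in
/-- Tuples of terminals and of components, minimal for the pattern `R`. -/
def ZZ (τ : P2 → ℝ) (M : ℕ) (m : ℝ) (R : Fin M → Fin M → Prop) :
    Set ((Fin M → P2) × (Fin M → NonemptyCompacts P2)) :=
  {z | (∀ i, z.1 i ∈ frontier (Qbox m)) ∧ (∀ i, IsPreconnected (z.2 i : Set P2)) ∧
    (∀ i, z.1 i ∈ (z.2 i : Set P2)) ∧ (∀ i j, R i j → z.2 i = z.2 j) ∧
    ∀ S, IsCompact S →
      (∀ i j, R i j → ∃ T ⊆ S, IsPreconnected T ∧ z.1 i ∈ T ∧ z.1 j ∈ T) →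
      tauLen τ (⋃ i, (z.2 i : Set P2)) ≤ tauLen τ S}

open TopologicalSpace in
theorem ZZ_closed {τ : P2 → ℝ} (hN : IsNorm τ) (M : ℕ) (m : ℝ) (R : Fin M → Fin M → Prop) :
    IsClosed (ZZ τ M m R) := by
  apply isClosed_of_closure_subset
  intro z hz
  have c1 : ∀ i, z.1 i ∈ frontier (Qbox m) := by
    intro i
    have : closure (ZZ τ M m R) ⊆ {z | z.1 i ∈ frontier (Qbox m)} :=
      closure_minimal (fun w hw => hw.1 i)
        (isClosed_frontier.preimage ((continuous_apply i).comp continuous_fst))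
    exact this hz
  have c2 : ∀ i, IsPreconnected (z.2 i : Set P2) := by
    intro i
    have : closure (ZZ τ M m R) ⊆ {z | IsPreconnected (z.2 i : Set P2)} :=
      closure_minimal (fun w hw => hw.2.1 i)
        (isClosed_preconn.preimage (f := fun z : (Fin M → P2) × (Fin M → NonemptyCompacts P2) =>
          z.2 i) ((continuous_apply i).comp continuous_snd))
    exact this hz
  have c3 : ∀ i, z.1 i ∈ (z.2 i : Set P2) := by
    intro i
    have : closure (ZZ τ M m R) ⊆ {z | z.1 i ∈ (z.2 i : Set P2)} :=
      closure_minimal (fun w hw => hw.2.2.1 i)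
        (isClosed_memNC.preimage (f := fun z : (Fin M → P2) × (Fin M → NonemptyCompacts P2) =>
          (z.1 i, z.2 i)) (((continuous_apply i).comp continuous_fst).prodMk
          ((continuous_apply i).comp continuous_snd)))
    exact this hz
  have c4 : ∀ i j, R i j → z.2 i = z.2 j := by
    intro i j hij
    have : closure (ZZ τ M m R) ⊆ {z | z.2 i = z.2 j} :=
      closure_minimal (fun w hw => hw.2.2.2.1 i j hij)
        (isClosed_eq ((continuous_apply i).comp continuous_snd)
          ((continuous_apply j).comp continuous_snd))
    exact this hz
  refine ⟨c1, c2, c3, c4, ?_⟩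
  intro S hS hSR
  by_cases htop : tauLen τ S = ⊤
  · rw [htop]; exact le_top
  obtain ⟨C, hC, hCb⟩ := tau_bound hN
  rw [← ENNReal.ofReal_toReal htop]
  refine golab hN (M := M) ENNReal.toReal_nonneg ?_
  intro δ hδ
  -- small parameter
  set η : ℝ := δ / (C * (M + 1) + C) / 2 with hη
  have hden : 0 < C * (M + 1) + C := by positivity
  have hη0 : 0 < η := by positivity
  have hηe : η * (C * (M + 1) + C) = δ / 2 := by rw [hη]; field_simp
  obtain ⟨w, hw, hwz⟩ := Metric.mem_closure_iff.1 hz η hη0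
  have hw1 : ∀ i, dist (z.1 i) (w.1 i) < η := fun i =>
    lt_of_le_of_lt ((dist_le_pi_dist z.1 w.1 i).trans (le_max_left _ _)) hwz
  have hw2 : ∀ i, dist (z.2 i) (w.2 i) < η := fun i =>
    lt_of_le_of_lt ((dist_le_pi_dist z.2 w.2 i).trans (le_max_right _ _)) hwz
  refine ⟨fun i => (w.2 i : Set P2), isCompact_iUnion fun i => (w.2 i).isCompact, hw.2.1, ?_, ?_⟩
  · let G : Set P2 := ⋃ i ∈ (Finset.univ : Finset (Fin M)), segment ℝ (z.1 i) (w.1 i)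
    have hGc : ListCov τ G (∑ i ∈ (Finset.univ : Finset (Fin M)), τ (w.1 i - z.1 i)) :=
      ListCov.biUnion _ (fun i => listCov_segment hN (z.1 i) (w.1 i))
    have hsegc : ∀ a b : P2, IsCompact (segment ℝ a b) := by
      intro a b
      rw [segment_eq_image_lineMap]
      exact isCompact_Icc.image (AffineMap.lineMap_continuous)
    have hGcomp : IsCompact G := Finset.univ.isCompact_biUnion fun i _ => hsegc _ _
    have key := hw.2.2.2.2 (S ∪ G) (hS.union hGcomp) (by
      intro i j hij
      obtain ⟨T, hTS, hT, hi, hj⟩ := hSR i j hij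
      refine ⟨T ∪ segment ℝ (z.1 i) (w.1 i) ∪ segment ℝ (z.1 j) (w.1 j), ?_, ?_, ?_, ?_⟩
      · refine Set.union_subset (Set.union_subset (hTS.trans Set.subset_union_left) ?_) ?_
        · exact (Set.subset_biUnion_of_mem (u := fun i => segment ℝ (z.1 i) (w.1 i))
            (Finset.mem_univ i)).trans Set.subset_union_right
        · exact (Set.subset_biUnion_of_mem (u := fun i => segment ℝ (z.1 i) (w.1 i))
            (Finset.mem_univ j)).trans Set.subset_union_right
      · refine IsPreconnected.union (z.1 j) (Or.inl hj) (left_mem_segment ℝ _ _) ?_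
          (convex_segment _ _).isPreconnected
        exact IsPreconnected.union (z.1 i) hi (left_mem_segment ℝ _ _) hT
          (convex_segment _ _).isPreconnected
      · exact Or.inl (Or.inr (right_mem_segment ℝ _ _))
      · exact Or.inr (right_mem_segment ℝ _ _))
    refine lt_of_le_of_lt (key.trans (tauLen_union_le hGc)) ?_
    have hsum : ∑ i ∈ (Finset.univ : Finset (Fin M)), τ (w.1 i - z.1 i) ≤ M * (C * η) := by
      calc _ ≤ ∑ i ∈ (Finset.univ : Finset (Fin M)), C * η := by
            refine Finset.sum_le_sum fun i _ => (hCb _).trans ?_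
            have := (hw1 i).le
            rw [dist_comm, dist_eq_norm] at this
            exact mul_le_mul_of_nonneg_left this hC.le
        _ = _ := by simp
    have hlt : ∑ i ∈ (Finset.univ : Finset (Fin M)), τ (w.1 i - z.1 i) < δ := by
      refine lt_of_le_of_lt hsum ?_
      nlinarith [mul_pos hη0 hC]
    conv_lhs => rw [← ENNReal.ofReal_toReal htop]
    rw [← ENNReal.ofReal_add ENNReal.toReal_nonneg
      (Finset.sum_nonneg fun i _ => tau_nonneg hN _)]
    exact (ENNReal.ofReal_lt_ofReal_iff (by positivity)).2 (by linarith)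
  · intro x hx
    obtain ⟨i, hxi⟩ := Set.mem_iUnion.1 hx
    have h2 := hw2 i
    rw [Metric.NonemptyCompacts.dist_eq] at h2
    obtain ⟨y, hy, hxy⟩ := Metric.exists_dist_lt_of_hausdorffDist_lt hxi h2
      (Metric.hausdorffEDist_ne_top_of_nonempty_of_bounded (z.2 i).nonempty (w.2 i).nonempty
        (z.2 i).isCompact.isBounded (w.2 i).isCompact.isBounded)
    refine ⟨y, Set.mem_iUnion.2 ⟨i, hy⟩, lt_of_le_of_lt (hCb _) ?_⟩
    rw [dist_eq_norm] at hxy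
    have : C * ‖x - y‖ ≤ C * η := mul_le_mul_of_nonneg_left hxy.le hC.le
    have : 0 ≤ η * (C * (M + 1)) := by positivity
    nlinarith


theorem tauLen_empty (τ : P2 → ℝ) : tauLen τ ∅ = 0 := by
  refine le_antisymm (tauLen_le_of fun ε hε e he => ⟨fun _ => ∅, by simp, ?_, ?_⟩) bot_le
  · intro i; rw [tauDiam_empty]; exact bot_le
  · simp [tauDiam_empty]

theorem norm_le_of_mem_frontier {m : ℝ} {x : P2} (hx : x ∈ frontier (Qbox m)) : ‖x‖ ≤ m := by
  have hc : IsClosed (Qbox m) := isClosed_Icc.prod isClosed_Icc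
  have h : x ∈ Qbox m := hc.frontier_subset hx
  obtain ⟨⟨h1, h2⟩, h3, h4⟩ := h
  rw [Prod.norm_def, max_le_iff, Real.norm_eq_abs, Real.norm_eq_abs, abs_le, abs_le]
  exact ⟨⟨h1, h2⟩, h3, h4⟩

open TopologicalSpace in
theorem ZZ_compact {τ : P2 → ℝ} (hN : IsNorm τ) (M : ℕ) (m : ℝ) (hm : 0 < m)
    (R : Fin M → Fin M → Prop) : IsCompact (ZZ τ M m R) := by
  obtain ⟨C, hC, hCb⟩ := tau_bound hN
  obtain ⟨D, hD, hDb⟩ := tau_lower hN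
  set L : ℝ := M * (C * m) + 1 with hL
  set ρ : ℝ := D * L + m with hρ
  have hQ : IsCompact (frontier (Qbox m)) :=
    (isCompact_Icc.prod isCompact_Icc : IsCompact (Qbox m)).of_isClosed_subset
      isClosed_frontier (isClosed_Icc.prod isClosed_Icc : IsClosed (Qbox m)).frontier_subset
  have hK : IsCompact ((Set.univ.pi fun _ : Fin M => frontier (Qbox m)) ×ˢ
      (Set.univ.pi fun _ : Fin M => {K : NonemptyCompacts P2 |
        (K : Set P2) ⊆ Metric.closedBall 0 ρ})) :=
    (isCompact_univ_pi fun _ => hQ).prod (isCompact_univ_pi fun _ =>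
      NonemptyCompacts.isCompact_subsets_of_isCompact (isCompact_closedBall 0 ρ))
  refine hK.of_isClosed_subset (ZZ_closed hN M m R) ?_
  intro z hz
  refine ⟨fun i _ => hz.1 i, fun i _ => ?_⟩
  show (z.2 i : Set P2) ⊆ Metric.closedBall 0 ρ
  let G : Set P2 := ⋃ i ∈ (Finset.univ : Finset (Fin M)), segment ℝ 0 (z.1 i)
  have hGc : ListCov τ G (∑ i ∈ (Finset.univ : Finset (Fin M)), τ (z.1 i - 0)) :=
    ListCov.biUnion _ (fun i => listCov_segment hN 0 (z.1 i))
  have hsegc : ∀ a b : P2, IsCompact (segment ℝ a b) := by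
    intro a b
    rw [segment_eq_image_lineMap]
    exact isCompact_Icc.image (AffineMap.lineMap_continuous)
  have hGcomp : IsCompact G := Finset.univ.isCompact_biUnion fun i _ => hsegc _ _
  have key := hz.2.2.2.2 G hGcomp (by
    intro i j _
    refine ⟨segment ℝ 0 (z.1 i) ∪ segment ℝ 0 (z.1 j), ?_, ?_, ?_, ?_⟩
    · refine Set.union_subset ?_ ?_
      · exact Set.subset_biUnion_of_mem (u := fun i => segment ℝ 0 (z.1 i)) (Finset.mem_univ i)
      · exact Set.subset_biUnion_of_mem (u := fun i => segment ℝ 0 (z.1 i)) (Finset.mem_univ j)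
    · exact IsPreconnected.union 0 (left_mem_segment ℝ _ _) (left_mem_segment ℝ _ _)
        (convex_segment _ _).isPreconnected (convex_segment _ _).isPreconnected
    · exact Or.inl (right_mem_segment ℝ _ _)
    · exact Or.inr (right_mem_segment ℝ _ _))
  have hG0 := tauLen_union_le (S := ∅) hGc
  rw [Set.empty_union, tauLen_empty, zero_add] at hG0
  have hsum : ∑ i ∈ (Finset.univ : Finset (Fin M)), τ (z.1 i - 0) ≤ M * (C * m) := by
    calc _ ≤ ∑ i ∈ (Finset.univ : Finset (Fin M)), C * m := by
          refine Finset.sum_le_sum fun i _ => (hCb _).trans ?_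
          rw [sub_zero]
          exact mul_le_mul_of_nonneg_left (norm_le_of_mem_frontier (hz.1 i)) hC.le
      _ = _ := by simp
  have hlt : tauLen τ (z.2 i : Set P2) < ENNReal.ofReal L := by
    refine lt_of_le_of_lt ((tauLen_mono (Set.subset_iUnion
      (fun i => (z.2 i : Set P2)) i)).trans (key.trans hG0)) ?_
    exact (ENNReal.ofReal_lt_ofReal_iff (by positivity)).2 (by linarith)
  have hDB := DB_of_connected hN (z.2 i).isCompact (hz.2.1 i) hlt
  intro x hx
  rw [mem_closedBall_zero_iff]
  have h1 := hDB x hx _ (hz.2.2.1 i)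
  have h2 := hDb (x - z.1 i)
  have h3 : ‖x‖ ≤ ‖x - z.1 i‖ + ‖z.1 i‖ := by simpa using norm_add_le (x - z.1 i) (z.1 i)
  have h4 := norm_le_of_mem_frontier (hz.1 i)
  have h5 := mul_le_mul_of_nonneg_left h1 hD.le
  linarith

open TopologicalSpace in
theorem coe_sup_fin {ι : Type*} (s : Finset ι) (hs : s.Nonempty) (f : ι → NonemptyCompacts P2) :
    ((s.sup' hs f : NonemptyCompacts P2) : Set P2) = ⋃ i ∈ s, (f i : Set P2) := by
  classical
  induction hs using Finset.Nonempty.cons_induction with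
  | singleton a => simp
  | cons a s ha hs ih =>
    rw [Finset.sup'_cons hs, NonemptyCompacts.coe_sup, ih]
    ext x; simp

theorem isCompact_compIn {F : Set P2} (hF : IsCompact F) {x : P2} (hx : x ∈ F) :
    IsCompact (connectedComponentIn F x) := by
  refine hF.of_isClosed_subset ?_ (connectedComponentIn_subset F x)
  apply isClosed_of_closure_subset
  refine IsPreconnected.subset_connectedComponentIn isPreconnected_connectedComponentIn.closure
    (subset_closure (mem_connectedComponentIn hx)) ?_
  exact closure_minimal (connectedComponentIn_subset F x) hF.isClosed

open TopologicalSpace in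
theorem forward {τ : P2 → ℝ} {M : ℕ} (hM : (Finset.univ : Finset (Fin M)).Nonempty) {m : ℝ}
    {F : NonemptyCompacts P2} (hF : (F : Set P2) ∈ OmegaMinMm τ M m) :
    ∃ R : Fin M → Fin M → Prop, ∃ z ∈ ZZ τ M m R, Finset.univ.sup' hM z.2 = F := by
  obtain ⟨E, r, Ep, hEQ, hEf, hEM, ⟨hne, hdis, hun⟩, ⟨⟨hFc, hFE⟩, hmin⟩, hcomp⟩ := hF
  have hEne : E.Nonempty := by
    obtain ⟨x, hx⟩ := F.nonempty
    obtain ⟨y, -, hy⟩ := hcomp x hx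
    exact ⟨y, hy⟩
  have hEF : E ⊆ F := by
    rw [← hun]
    refine Set.iUnion_subset fun j => ?_
    obtain ⟨x, -, hx⟩ := hFE j
    exact hx.trans (connectedComponentIn_subset _ _)
  obtain ⟨p, hp⟩ : ∃ p : Fin M → P2, Set.range p = E := by
    have : Fintype E := hEf.fintype
    have : Nonempty E := hEne.to_subtype
    have hcard : Fintype.card E ≤ Fintype.card (Fin M) := by
      rw [Fintype.card_fin, ← Nat.card_eq_fintype_card]; exact hEM
    obtain ⟨g⟩ := Function.Embedding.nonempty_of_card_le hcard
    refine ⟨fun i => ((Function.invFun g i : E) : P2), ?_⟩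
    ext x
    constructor
    · rintro ⟨i, rfl⟩; exact (Function.invFun g i).2
    · intro hx
      obtain ⟨i, hi⟩ := Function.invFun_surjective g.injective ⟨x, hx⟩
      exact ⟨i, by simp [hi]⟩
  have hpE : ∀ i, p i ∈ E := fun i => hp ▸ Set.mem_range_self i
  have hpF : ∀ i, p i ∈ (F : Set P2) := fun i => hEF (hpE i)
  let c : Fin M → NonemptyCompacts P2 := fun i =>
    ⟨⟨connectedComponentIn F (p i), isCompact_compIn hFc (hpF i)⟩,
      ⟨p i, mem_connectedComponentIn (hpF i)⟩⟩
  have hcc : ∀ i, (c i : Set P2) = connectedComponentIn F (p i) := fun i => rfl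
  have hU : (⋃ i, (c i : Set P2)) = F := by
    apply subset_antisymm
    · exact Set.iUnion_subset fun i => connectedComponentIn_subset _ _
    · intro x hx
      obtain ⟨y, hy, hyE⟩ := hcomp x hx
      rw [← hp] at hyE
      obtain ⟨i, rfl⟩ := hyE
      refine Set.mem_iUnion.2 ⟨i, ?_⟩
      rw [hcc, ← connectedComponentIn_eq hy]
      exact mem_connectedComponentIn hx
  refine ⟨fun i j => c i = c j, (p, c), ⟨fun i => hEQ (hpE i),
    fun i => isPreconnected_connectedComponentIn, fun i => mem_connectedComponentIn (hpF i),
    fun i j h => h, ?_⟩, ?_⟩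
  · intro S hS hSR
    show tauLen τ (⋃ i, (c i : Set P2)) ≤ _
    rw [hU, hmin]
    refine iInf₂_le S ⟨hS, fun j => ?_⟩
    obtain ⟨x, hx⟩ := hne j
    have hsub : Ep j ⊆ E := hun ▸ Set.subset_iUnion Ep j
    obtain ⟨w, hwF, hw⟩ := hFE j
    have main : ∀ y ∈ Ep j, ∃ T ⊆ S, IsPreconnected T ∧ x ∈ T ∧ y ∈ T := by
      intro y hy
      have hxE := hsub hx
      have hyE := hsub hy
      rw [← hp] at hxE hyE
      obtain ⟨i, hi⟩ := hxE
      obtain ⟨k, hk⟩ := hyE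
      have : c i = c k := by
        apply NonemptyCompacts.ext
        show connectedComponentIn _ _ = connectedComponentIn _ _
        rw [hi, hk, ← connectedComponentIn_eq (hw hx), ← connectedComponentIn_eq (hw hy)]
      obtain ⟨T, h1, h2, h3, h4⟩ := hSR i k this
      exact ⟨T, h1, h2, hi ▸ h3, hk ▸ h4⟩
    obtain ⟨T, hTS, -, hxT, -⟩ := main x hx
    refine ⟨x, hTS hxT, fun y hy => ?_⟩
    obtain ⟨T, hTS, hT, hxT, hyT⟩ := main y hy
    exact hT.subset_connectedComponentIn hxT hTS hyT
  · apply NonemptyCompacts.ext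
    show ((_ : NonemptyCompacts P2) : Set P2) = (F : Set P2)
    rw [coe_sup_fin]
    simpa using hU

open TopologicalSpace in
theorem backward {τ : P2 → ℝ} {M : ℕ} {m : ℝ} {R : Fin M → Fin M → Prop}
    {z : (Fin M → P2) × (Fin M → NonemptyCompacts P2)} (hz : z ∈ ZZ τ M m R) :
    (⋃ i, (z.2 i : Set P2)) ∈ OmegaMinMm τ M m := by
  classical
  obtain ⟨p, c⟩ := z
  obtain ⟨h1, h2, h3, h4, h5⟩ := hz
  dsimp only at h1 h2 h3 h4 h5 ⊢
  set F : Set P2 := ⋃ i, (c i : Set P2) with hF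
  have hFc : IsCompact F := isCompact_iUnion fun i => (c i).isCompact
  have hcF : ∀ i, (c i : Set P2) ⊆ F := fun i => Set.subset_iUnion (fun i => (c i : Set P2)) i
  have hpF : ∀ i, p i ∈ F := fun i => hcF i (h3 i)
  have hcC : ∀ i, (c i : Set P2) ⊆ connectedComponentIn F (p i) := fun i =>
    (h2 i).subset_connectedComponentIn (h3 i) (hcF i)
  let Q : Set (Set P2) := Set.range fun i => connectedComponentIn F (p i)
  have hQ : Q.Finite := Set.finite_range _
  have : Fintype Q := hQ.fintype
  let e : Fin (Fintype.card Q) ≃ Q := (Fintype.equivFin Q).symm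
  let Ep : Fin (Fintype.card Q) → Set P2 := fun j =>
    {x | x ∈ Set.range p ∧ connectedComponentIn F x = (e j : Set P2)}
  have hEp : ∀ i, ∃ j, p i ∈ Ep j := by
    intro i
    refine ⟨e.symm ⟨connectedComponentIn F (p i), ⟨i, rfl⟩⟩, ⟨i, rfl⟩, ?_⟩
    simp
  have hOm : F ∈ OmegaSet Ep := by
    refine ⟨hFc, fun j => ?_⟩
    obtain ⟨i, hi⟩ := (e j).2
    refine ⟨p i, hpF i, ?_⟩
    rintro x ⟨⟨k, rfl⟩, hk⟩
    have hi' : connectedComponentIn F (p i) = (e j : Set P2) := hi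
    rw [hi', ← hk]
    exact mem_connectedComponentIn (hpF k)
  refine ⟨Set.range p, Fintype.card Q, Ep, ?_, Set.finite_range p, ?_, ⟨?_, ?_, ?_⟩,
    ⟨hOm, ?_⟩, ?_⟩
  · rintro _ ⟨i, rfl⟩; exact h1 i
  · have := Set.ncard_image_le (f := p) (Set.finite_univ (α := Fin M))
    rw [Set.image_univ] at this
    simpa [Set.ncard_univ] using this
  · intro j
    obtain ⟨i, hi⟩ := (e j).2
    exact ⟨p i, ⟨i, rfl⟩, hi⟩
  · intro j k hjk
    rw [Set.disjoint_left]
    rintro x ⟨-, hx⟩ ⟨-, hx'⟩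
    exact hjk (e.injective (Subtype.ext (hx.symm.trans hx')))
  · apply subset_antisymm
    · exact Set.iUnion_subset fun j x hx => hx.1
    · rintro _ ⟨i, rfl⟩
      exact Set.mem_iUnion.2 (hEp i)
  · refine le_antisymm (le_iInf₂ fun S hS => ?_) (iInf₂_le F hOm)
    refine h5 S hS.1 fun i k hik => ?_
    obtain ⟨j, hj⟩ := hEp i
    have hk : p k ∈ Ep j := by
      refine ⟨⟨k, rfl⟩, ?_⟩
      rw [← hj.2]
      have : p k ∈ connectedComponentIn F (p i) := by
        apply hcC i
        rw [h4 i k hik]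
        exact h3 k
      exact (connectedComponentIn_eq this).symm
    obtain ⟨x, hxS, hx⟩ := hS.2 j
    exact ⟨connectedComponentIn S x, connectedComponentIn_subset _ _,
      isPreconnected_connectedComponentIn, hx hj, hx hk⟩
  · intro x hx
    obtain ⟨i, hi⟩ := Set.mem_iUnion.1 hx
    refine ⟨p i, ?_, i, rfl⟩
    rw [← connectedComponentIn_eq (hcC i hi)]
    exact mem_connectedComponentIn (hpF i)

open TopologicalSpace in
theorem main {τ : P2 → ℝ} (hN : IsNorm τ) (m : ℝ) (hm : 0 < m) (M : ℕ) :
    IsCompact {F : NonemptyCompacts P2 | (F : Set P2) ∈ OmegaMinMm τ M m} := by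
  rcases Nat.eq_zero_or_pos M with rfl | hM
  · convert isCompact_empty
    rw [Set.eq_empty_iff_forall_notMem]
    rintro F ⟨E, r, Ep, hEQ, hEf, hEM, -, -, hcomp⟩
    obtain ⟨x, hx⟩ := F.nonempty
    obtain ⟨y, -, hy⟩ := hcomp x hx
    have : E = ∅ := (Set.ncard_eq_zero hEf).1 (Nat.le_zero.1 hEM)
    rw [this] at hy
    exact hy
  · have hU : (Finset.univ : Finset (Fin M)).Nonempty := ⟨⟨0, hM⟩, Finset.mem_univ _⟩
    let φ : (Fin M → P2) × (Fin M → NonemptyCompacts P2) → NonemptyCompacts P2 :=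
      fun z => Finset.univ.sup' hU z.2
    have hφ : Continuous φ := by
      refine Continuous.finset_sup'_apply (f := fun i
        (z : (Fin M → P2) × (Fin M → NonemptyCompacts P2)) => z.2 i) hU fun i _ => ?_
      exact (continuous_apply i).comp continuous_snd
    have hcov : {F : NonemptyCompacts P2 | (F : Set P2) ∈ OmegaMinMm τ M m} =
        ⋃ R : Fin M → Fin M → Prop, φ '' ZZ τ M m R := by
      ext F
      simp only [Set.mem_iUnion]
      constructor
      · intro hF
        obtain ⟨R, z, hz, h⟩ := forward hU hF
        exact ⟨R, z, hz, h⟩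
      · rintro ⟨R, z, hz, rfl⟩
        have := backward hz
        show ((Finset.univ.sup' hU z.2 : NonemptyCompacts P2) : Set P2) ∈ OmegaMinMm τ M m
        rw [coe_sup_fin]
        simpa using this
    rw [hcov]
    exact isCompact_iUnion fun R => (ZZ_compact hN M m hm R).image hφ

end Steiner

/-- For a strictly convex norm `τ`, `m > 0` and `M ∈ ℕ`, the set
`Ω^min_{M,m}` is a compact subset of the space of nonempty compact subsets of `ℝ²` with the
Hausdorff metric. -/
theorem statement13 (τ : P2 → ℝ) (hτ : IsStrictlyConvexNorm τ) (m : ℝ) (hm : 0 < m)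
    (M : ℕ) :
    IsCompact {F : TopologicalSpace.NonemptyCompacts P2 | (F : Set P2) ∈ OmegaMinMm τ M m} := by
  exact Steiner.main hτ.1 m hm M
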